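/- arXiv:1510.06207 — 2 statements merged into one kernel-verified Lean document; each statement's English description precedes it below -/
import Mathlib

section
/- Delta-method for the bootstrap, outer-probability version (Theorem 3.1(iii)): Assume conditions (a)–(e) of the almost-sure bootstrap delta-method, and instead of (f) assume (f'): a_n(T̂_n* − θ) and a_n(T̂_n* − T̂_n) take values only in E and are (ℱ̄,ℬ°)-measurable, and for every δ > 0 the outer probability ℙ^out[{ω ∈ Ω : d_BL°(P_n(ω,·), law(ξ)) ≥ δ}] → 0 as n → ∞, where P_n(ω,A) := ℙ'[{ω' ∈ Ω' : a_n(T̂_n*(ω,ω') − T̂_n(ω)) ∈ A}] for A ∈ ℬ°. Then a_n(f(T̂_n*) − f(T̂_n)) is (ℱ̄,ℬ̃)-measurable, ḟ_θ(ξ) is (ℱ₀,ℬ̃)-measurable, and for every δ > 0, ℙ[{ω ∈ Ω : d̃_BL(P̃_n(ω,·), law(ḟ_θ(ξ))) ≥ δ}] → 0 as n → ∞, where P̃_n(ω,A) := ℙ'[{ω' : a_n(f(T̂_n*(ω,ω')) − f(T̂_n(ω))) ∈ A}] for A ∈ ℬ̃. -/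
open MeasureTheory Filter Topology

/-- The open-ball σ-algebra on a (pseudo)metric space: the σ-algebra generated by the
open balls. -/
def ballSigma (E : Type*) [PseudoMetricSpace E] : MeasurableSpace E :=
  MeasurableSpace.generateFrom {s : Set E | ∃ (x : E) (r : ℝ), 0 < r ∧ s = Metric.ball x r}

/-- The bounded Lipschitz distance between two measures, built from the class of
measurable functions bounded by `1` and Lipschitz with constant `1`. -/
noncomputable def dBL {G : Type*} [PseudoMetricSpace G] [MeasurableSpace G]
    (μ ν : Measure G) : ℝ :=
  sSup ((fun g => |∫ x, g x ∂μ - ∫ x, g x ∂ν|) ''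
    {g : G → ℝ | Measurable g ∧ (∀ x, |g x| ≤ 1) ∧ ∀ x y, |g x - g y| ≤ dist x y})

/-- Bounded convergence in measure implies convergence of the absolute integrals. -/
theorem tendsto_integral_abs_of_tendsto_measureReal {S : Type*} [MeasurableSpace S]
    {μ : Measure S} [IsProbabilityMeasure μ] {h : ℕ → S → ℝ} (hm : ∀ n, Measurable (h n))
    {C : ℝ} (hC : ∀ n x, |h n x| ≤ C)
    (hlim : ∀ ε : ℝ, 0 < ε → Tendsto (fun n => μ.real {x | ε ≤ |h n x|}) atTop (𝓝 0)) :
    Tendsto (fun n => ∫ x, |h n x| ∂μ) atTop (𝓝 0) := by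
  have key : ∀ ε : ℝ, 0 < ε → ∀ n, ∫ x, |h n x| ∂μ ≤ ε + C * μ.real {x | ε ≤ |h n x|} := by
    intro ε hε n
    have hS : MeasurableSet {x | ε ≤ |h n x|} := measurableSet_le measurable_const (hm n).abs
    have hint : Integrable ({x | ε ≤ |h n x|}.indicator fun _ => C) μ :=
      (integrable_const C).indicator hS
    calc ∫ x, |h n x| ∂μ
        ≤ ∫ x, (ε + {x | ε ≤ |h n x|}.indicator (fun _ => C) x) ∂μ := by
          refine integral_mono_of_nonneg (.of_forall fun x => abs_nonneg _)
            ((integrable_const ε).add hint) (.of_forall fun x => ?_)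
          by_cases hx : ε ≤ |h n x|
          · simp only [Set.indicator, Set.mem_ofPred_eq, hx, if_true]
            linarith [hC n x]
          · simp only [Set.indicator, Set.mem_ofPred_eq, hx, if_false]
            linarith
      _ = ε + C * μ.real {x | ε ≤ |h n x|} := by
          rw [integral_add (integrable_const ε) hint, integral_indicator_const _ hS]
          simp [mul_comm]
  rw [Metric.tendsto_atTop]
  intro ε hε
  have h1 := (hlim (ε / 2) (half_pos hε)).const_mul C
  rw [mul_zero] at h1
  obtain ⟨N, hN⟩ := eventually_atTop.1 (h1.eventually (gt_mem_nhds (half_pos hε)))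
  refine ⟨N, fun n hn => ?_⟩
  have h0 : 0 ≤ ∫ x, |h n x| ∂μ := integral_nonneg fun x => abs_nonneg _
  rw [Real.dist_eq, sub_zero, abs_of_nonneg h0]
  linarith [key (ε / 2) (half_pos hε) n, hN n hn]

section BoundedLipschitz

variable {G : Type*} [PseudoMetricSpace G] [MeasurableSpace G]

theorem abs_integral_sub_integral_le_dBL {μ ν : Measure G} [IsProbabilityMeasure μ]
    [IsProbabilityMeasure ν] {g : G → ℝ} (hg : Measurable g) {L : ℝ} (hL : 0 < L)
    (hb : ∀ x, |g x| ≤ L) (hlip : ∀ x y, |g x - g y| ≤ L * dist x y) :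
    |∫ x, g x ∂μ - ∫ x, g x ∂ν| ≤ L * dBL μ ν := by
  have hbdd : BddAbove ((fun g => |∫ x, g x ∂μ - ∫ x, g x ∂ν|) ''
      {g : G → ℝ | Measurable g ∧ (∀ x, |g x| ≤ 1) ∧ ∀ x y, |g x - g y| ≤ dist x y}) := by
    refine ⟨2, ?_⟩
    rintro _ ⟨k, ⟨-, hk, -⟩, rfl⟩
    have h1 := norm_integral_le_of_norm_le_const (μ := μ) (f := k) (C := 1) (.of_forall hk)
    have h2 := norm_integral_le_of_norm_le_const (μ := ν) (f := k) (C := 1) (.of_forall hk)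
    simp only [Real.norm_eq_abs, probReal_univ, mul_one] at h1 h2
    have := abs_sub (∫ x, k x ∂μ) (∫ x, k x ∂ν)
    simp only
    linarith
  have hmem : |∫ x, L⁻¹ * g x ∂μ - ∫ x, L⁻¹ * g x ∂ν| ≤ dBL μ ν := by
    refine le_csSup hbdd ⟨fun x => L⁻¹ * g x, ⟨hg.const_mul _, fun x => ?_, fun x y => ?_⟩, rfl⟩
    · rw [abs_mul, abs_of_pos (inv_pos.2 hL), inv_mul_le_iff₀ hL, mul_one]
      exact hb x
    · rw [← mul_sub, abs_mul, abs_of_pos (inv_pos.2 hL), inv_mul_le_iff₀ hL]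
      exact hlip x y
  rw [integral_const_mul, integral_const_mul, ← mul_sub, abs_mul, abs_of_pos (inv_pos.2 hL),
    inv_mul_le_iff₀ hL] at hmem
  exact hmem

theorem dBL_le {μ ν : Measure G} {c : ℝ}
    (h : ∀ g : G → ℝ, Measurable g → (∀ x, |g x| ≤ 1) → (∀ x y, |g x - g y| ≤ dist x y) →
      |∫ x, g x ∂μ - ∫ x, g x ∂ν| ≤ c) : dBL μ ν ≤ c := by
  refine csSup_le ⟨_, 0, ⟨measurable_const, by simp, by simp⟩, rfl⟩ ?_
  rintro _ ⟨g, ⟨h1, h2, h3⟩, rfl⟩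
  exact h g h1 h2 h3

end BoundedLipschitz

section BallSigma

theorem measurable_dist_const_of_ballSigma {E : Type*} [PseudoMetricSpace E]
    [mE : MeasurableSpace E]
    (hmE : mE = ballSigma E) (y : E) : Measurable fun x : E => dist x y := by
  refine measurable_of_Iio fun r => ?_
  rcases le_or_gt r 0 with hr | hr
  · convert MeasurableSet.empty
    ext x
    simp only [Set.mem_preimage, Set.mem_Iio, Set.mem_empty_iff_false, iff_false, not_lt]
    exact hr.trans dist_nonneg
  · subst hmE
    exact MeasurableSpace.measurableSet_generateFrom ⟨y, r, hr, rfl⟩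

theorem measurable_of_measurableSet_preimage_ball {E : Type*} [PseudoMetricSpace E]
    [mE : MeasurableSpace E] (hmE : mE = ballSigma E) {α : Type*} [MeasurableSpace α] {u : α → E}
    (hu : ∀ (y : E) (r : ℝ), MeasurableSet (u ⁻¹' Metric.ball y r)) : Measurable u := by
  subst hmE
  refine measurable_generateFrom ?_
  rintro _ ⟨y, r, -, rfl⟩
  exact hu y r

/-- Addition of a separably valued measurable map is jointly measurable for the open-ball
σ-algebra. -/
theorem measurable_add_of_isSeparable {E : Type*} [NormedAddCommGroup E] [mE : MeasurableSpace E]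
    (hmE : mE = ballSigma E) {s : Set E} (hs : TopologicalSpace.IsSeparable s)
    {Ω₀ : Type*} [MeasurableSpace Ω₀] {ξ : Ω₀ → E} (hξ : Measurable ξ) (hmem : ∀ w, ξ w ∈ s) :
    Measurable fun p : E × Ω₀ => p.1 + ξ p.2 := by
  obtain ⟨t, htc, hst⟩ := hs
  have hgen : ∀ (y : E) (r : ℝ),
      MeasurableSet ((fun p : E × Ω₀ => p.1 + ξ p.2) ⁻¹' Metric.ball y r) := by
    intro y r
    have heq : (fun p : E × Ω₀ => p.1 + ξ p.2) ⁻¹' Metric.ball y r =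
        ⋃ d ∈ t, {p : E × Ω₀ | dist p.1 (y - d) + dist (ξ p.2) d < r} := by
      ext ⟨x, w⟩
      simp only [Set.mem_preimage, Metric.mem_ball, Set.mem_iUnion, Set.mem_ofPred_eq, exists_prop]
      constructor
      · intro h
        obtain ⟨d, hd, hdist⟩ := Metric.mem_closure_iff.1 (hst (hmem w))
          ((r - dist (x + ξ w) y) / 2) (by linarith)
        refine ⟨d, hd, ?_⟩
        have h2 : dist x (y - d) ≤ dist (x + ξ w) y + dist (ξ w) d := by
          simp only [dist_eq_norm]
          calc ‖x - (y - d)‖ = ‖(x + ξ w - y) - (ξ w - d)‖ := by congr 1; abel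
            _ ≤ _ := norm_sub_le _ _
        linarith
      · rintro ⟨d, -, h⟩
        have h2 : dist (x + ξ w) y ≤ dist x (y - d) + dist (ξ w) d := by
          simp only [dist_eq_norm]
          calc ‖x + ξ w - y‖ = ‖(x - (y - d)) + (ξ w - d)‖ := by congr 1; abel
            _ ≤ _ := norm_add_le _ _
        linarith
    rw [heq]
    refine MeasurableSet.biUnion htc fun d _ => measurableSet_lt ?_ measurable_const
    exact ((measurable_dist_const_of_ballSigma hmE _).comp measurable_fst).add
      (((measurable_dist_const_of_ballSigma hmE _).comp hξ).comp measurable_snd)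
  exact measurable_of_measurableSet_preimage_ball hmE hgen

end BallSigma

/-- If `X n` converges to a separably valued `η` when tested against bounded Lipschitz
functions measurable for the open-ball σ-algebra, and every point of the range of `η` has a
neighbourhood that eventually misses the sets `B n`, then `X n` is asymptotically outside `B n`. -/
theorem tendsto_measureReal_mem_of_locally_avoid {E : Type*} [PseudoMetricSpace E]
    [mE : MeasurableSpace E] (hmE : mE = ballSigma E)
    {s : Set E} (hs : TopologicalSpace.IsSeparable s)
    {S S₀ : Type*} [MeasurableSpace S] [MeasurableSpace S₀] {μ : Measure S}
    [IsProbabilityMeasure μ] {ν : Measure S₀} [IsProbabilityMeasure ν]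
    {X : ℕ → S → E} (hX : ∀ n, Measurable (X n)) {η : S₀ → E} (hη : Measurable η)
    (hηs : ∀ w, η w ∈ s)
    (hconv : ∀ (g : E → ℝ) (L : ℝ), Measurable g → 0 < L → (∀ x, |g x| ≤ L) →
      (∀ x y, |g x - g y| ≤ L * dist x y) →
      Tendsto (fun n => ∫ w, g (X n w) ∂μ) atTop (𝓝 (∫ w, g (η w) ∂ν)))
    {B : ℕ → Set E}
    (hB : ∀ x₀ ∈ s, ∃ δ : ℝ, 0 < δ ∧ ∃ N : ℕ, ∀ n, N ≤ n → ∀ x, dist x x₀ < δ → x ∉ B n) :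
    Tendsto (fun n => μ.real {w | X n w ∈ B n}) atTop (𝓝 0) := by
  choose! δ hδ N hN using hB
  obtain ⟨w₀⟩ : Nonempty S₀ := nonempty_of_isProbabilityMeasure ν
  have hlin : IsLindelof s := by
    have := hs.secondCountableTopology
    exact IsLindelof.of_coe
  obtain ⟨t, htc, hts, hcov⟩ := hlin.elim_nhds_subcover (fun x => Metric.ball x (δ x))
    fun x hx => Metric.ball_mem_nhds x (hδ x hx)
  have htne : t.Nonempty := by
    obtain ⟨x, hx, -⟩ := Set.mem_iUnion₂.1 (hcov (hηs w₀))
    exact ⟨x, hx⟩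
  obtain ⟨y, rfl⟩ := htc.exists_eq_range htne
  have hys : ∀ k, y k ∈ s := fun k => hts _ ⟨k, rfl⟩
  set g : ℕ → E → ℝ := fun M x =>
    min 1 ((M : ℝ) * ∑ k ∈ Finset.range M, max 0 (δ (y k) - dist x (y k))) with hg
  have hsum0 : ∀ M x, 0 ≤ ∑ k ∈ Finset.range M, max 0 (δ (y k) - dist x (y k)) :=
    fun M x => Finset.sum_nonneg fun k _ => le_max_left _ _
  have hg0 : ∀ M x, 0 ≤ g M x := fun M x =>
    le_min zero_le_one (mul_nonneg (Nat.cast_nonneg _) (hsum0 M x))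
  have hg1 : ∀ M x, g M x ≤ 1 := fun M x => min_le_left _ _
  have hgabs : ∀ M x, |g M x| ≤ 1 := fun M x => by
    rw [abs_of_nonneg (hg0 M x)]; exact hg1 M x
  have hgm : ∀ M, Measurable (g M) := fun M =>
    measurable_const.min (measurable_const.mul (Finset.measurable_sum _ fun k _ =>
      measurable_const.max (measurable_const.sub (measurable_dist_const_of_ballSigma hmE _))))
  have hglip : ∀ (M : ℕ) x x', |g M x - g M x'| ≤ ((M : ℝ) * M + 1) * dist x x' := by
    intro M x x'
    have hterm : ∀ k, |max 0 (δ (y k) - dist x (y k)) - max 0 (δ (y k) - dist x' (y k))|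
        ≤ dist x x' := fun k => by
      refine (abs_max_sub_max_le_max _ _ _ _).trans (max_le (by simp) ?_)
      rw [sub_sub_sub_cancel_left, abs_sub_comm]
      exact abs_dist_sub_le x x' (y k)
    calc |g M x - g M x'|
        ≤ |(M : ℝ) * ∑ k ∈ Finset.range M, max 0 (δ (y k) - dist x (y k)) -
            (M : ℝ) * ∑ k ∈ Finset.range M, max 0 (δ (y k) - dist x' (y k))| := by
          simpa using abs_min_sub_min_le_max 1
            ((M : ℝ) * ∑ k ∈ Finset.range M, max 0 (δ (y k) - dist x (y k))) 1
            ((M : ℝ) * ∑ k ∈ Finset.range M, max 0 (δ (y k) - dist x' (y k)))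
      _ = M * |∑ k ∈ Finset.range M, (max 0 (δ (y k) - dist x (y k)) -
            max 0 (δ (y k) - dist x' (y k)))| := by
          rw [← mul_sub, abs_mul, Nat.abs_cast, Finset.sum_sub_distrib]
      _ ≤ M * ∑ k ∈ Finset.range M, dist x x' := by
          gcongr
          exact (Finset.abs_sum_le_sum_abs _ _).trans (Finset.sum_le_sum fun k _ => hterm k)
      _ = (M * M : ℝ) * dist x x' := by simp [mul_assoc]
      _ ≤ _ := by nlinarith [dist_nonneg (x := x) (y := x')]
  have hglim : Tendsto (fun M => ∫ w, g M (η w) ∂ν) atTop (𝓝 1) := by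
    have : (1 : ℝ) = ∫ _, (1 : ℝ) ∂ν := by simp
    rw [this]
    refine tendsto_integral_of_dominated_convergence (fun _ => 1)
      (fun M => ((hgm M).comp hη).aestronglyMeasurable) (integrable_const _)
      (fun M => .of_forall fun w => hgabs M _) (.of_forall fun w => ?_)
    obtain ⟨_, ⟨k, rfl⟩, hk⟩ := Set.mem_iUnion₂.1 (hcov (hηs w))
    have hpos : 0 < δ (y k) - dist (η w) (y k) := sub_pos.2 hk
    refine tendsto_const_nhds.congr' ?_
    filter_upwards [eventually_gt_atTop k,
      (tendsto_natCast_atTop_atTop (R := ℝ)).eventually_ge_atTop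
        (δ (y k) - dist (η w) (y k))⁻¹] with M hM1 hM2
    refine (min_eq_left ?_).symm
    have h1 : δ (y k) - dist (η w) (y k) ≤
        ∑ k ∈ Finset.range M, max 0 (δ (y k) - dist (η w) (y k)) :=
      (le_max_right 0 _).trans (Finset.single_le_sum
        (f := fun k => max 0 (δ (y k) - dist (η w) (y k)))
        (fun _ _ => le_max_left _ _) (Finset.mem_range.2 hM1))
    calc (1 : ℝ) = (δ (y k) - dist (η w) (y k))⁻¹ * (δ (y k) - dist (η w) (y k)) :=
          (inv_mul_cancel₀ hpos.ne').symm
      _ ≤ _ := mul_le_mul hM2 h1 hpos.le (Nat.cast_nonneg _)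
  rw [Metric.tendsto_atTop]
  intro ε hε
  obtain ⟨M, hM⟩ := (hglim.eventually (lt_mem_nhds (show 1 - ε < 1 by linarith))).exists
  have hgX := (hconv (g M) ((M : ℝ) * M + 1) (hgm M) (by positivity)
    (fun x => (hgabs M x).trans (by nlinarith [(Nat.cast_nonneg M : (0 : ℝ) ≤ M)]))
    (hglip M)).eventually (lt_mem_nhds hM)
  obtain ⟨n₁, hn₁⟩ := eventually_atTop.1 hgX
  refine ⟨max n₁ ((Finset.range M).sup fun k => N (y k)), fun n hn => ?_⟩
  have hsub : {w | X n w ∈ B n} ⊆ {w | 1 ≤ 1 - g M (X n w)} := by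
    intro w hw
    have hfar : ∀ k ∈ Finset.range M, max 0 (δ (y k) - dist (X n w) (y k)) = 0 := by
      intro k hk
      refine max_eq_left ?_
      by_contra! hlt
      exact hN _ (hys k) n ((Finset.le_sup (f := fun k => N (y k)) hk).trans
        ((le_max_right _ _).trans hn)) _ (sub_pos.1 hlt) hw
    have : g M (X n w) = 0 := by
      simp only [hg]
      rw [Finset.sum_eq_zero hfar]
      simp
    simp [this]
  have hint : Integrable (fun w => g M (X n w)) μ :=
    .of_bound ((hgm M).comp (hX n)).aestronglyMeasurable 1 (.of_forall fun w => hgabs M _)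
  have hmarkov := mul_meas_ge_le_integral_of_nonneg (μ := μ) (f := fun w => 1 - g M (X n w))
    (.of_forall fun w => sub_nonneg.2 (hg1 M _)) ((integrable_const 1).sub hint) 1
  rw [integral_sub (integrable_const 1) hint] at hmarkov
  simp only [integral_const, probReal_univ, smul_eq_mul, mul_one, one_mul] at hmarkov
  have hle := measureReal_mono (μ := μ) hsub
  rw [Real.dist_eq, sub_zero, abs_of_nonneg measureReal_nonneg]
  linarith [hn₁ n ((le_max_left _ _).trans hn)]

/-- The remainder of a quasi-Hadamard expansion is uniformly small near each tangent direction. -/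
theorem exists_locally_small_remainder_of_quasiHadamard {V E F : Type*} [AddCommGroup V]
    [Module ℝ V] [NormedAddCommGroup E] [NormedSpace ℝ E] [NormedAddCommGroup F] [NormedSpace ℝ F]
    {ι : E →ₗ[ℝ] V} {Vf : Set V} {f : V → F} {θ : V} {a : ℕ → ℝ} (ha_pos : ∀ n, 0 < a n)
    (ha_top : Tendsto a atTop atTop) {f' : E → F} {x₀ : E}
    (hqH : ∀ xs : ℕ → E, ∀ εs : ℕ → ℝ,
      (∀ n, 0 < εs n) → Tendsto εs atTop (𝓝 0) →
      Tendsto (fun n => ‖xs n - x₀‖) atTop (𝓝 0) →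
      (∀ n, θ + εs n • ι (xs n) ∈ Vf) →
      Tendsto (fun n => ‖f' x₀ - (εs n)⁻¹ • (f (θ + εs n • ι (xs n)) - f θ)‖) atTop (𝓝 0))
    (hcont : ContinuousAt f' x₀) {ε : ℝ} (hε : 0 < ε) :
    ∃ δ : ℝ, 0 < δ ∧ ∃ N : ℕ, ∀ n, N ≤ n → ∀ x, dist x x₀ < δ →
      x ∉ {x | θ + (a n)⁻¹ • ι x ∈ Vf ∧
        ε ≤ ‖a n • (f (θ + (a n)⁻¹ • ι x) - f θ) - f' x‖} := by
  by_contra! hcon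
  choose k hk x hx hbad using fun m : ℕ => hcon (1 / ((m : ℝ) + 1)) (by positivity) m
  have hk_top : Tendsto k atTop atTop := tendsto_atTop_mono hk tendsto_id
  have hxlim : Tendsto x atTop (𝓝 x₀) := by
    rw [tendsto_iff_dist_tendsto_zero]
    exact squeeze_zero (fun _ => dist_nonneg) (fun m => (hx m).le)
      tendsto_one_div_add_atTop_nhds_zero_nat
  have h1 := hqH x (fun m => (a (k m))⁻¹) (fun m => inv_pos.2 (ha_pos _))
    (tendsto_inv_atTop_zero.comp (ha_top.comp hk_top))
    (tendsto_iff_norm_sub_tendsto_zero.1 hxlim) (fun m => (hbad m).1)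
  have h2 := tendsto_iff_norm_sub_tendsto_zero.1 (hcont.tendsto.comp hxlim)
  have h3 := (h1.add h2).eventually (gt_mem_nhds (show (0 : ℝ) + 0 < ε by linarith))
  obtain ⟨m, hm⟩ := h3.exists
  refine absurd (hbad m).2 (not_le.2 (lt_of_le_of_lt ?_ hm))
  simp only [inv_inv, Function.comp_apply]
  rw [norm_sub_rev (f' x₀), norm_sub_rev (f' (x m))]
  exact norm_sub_le_norm_sub_add_norm_sub _ _ _

/-- If the conditional laws of `Y n` given the first coordinate converge in outer probability to
the law of `ξ` and `Z n` converges in distribution to `ξ`, then `Y n + Z n` converges to the sum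
of two independent copies of `ξ`. -/
theorem tendsto_integral_add_of_tendsto_conditional_dBL {E : Type*} [NormedAddCommGroup E]
    [mE : MeasurableSpace E] (hmE : mE = ballSigma E)
    {s : Set E} (hs : TopologicalSpace.IsSeparable s)
    {Ω Ω' Ω₀ : Type*} [MeasurableSpace Ω] [MeasurableSpace Ω'] [MeasurableSpace Ω₀]
    {P : Measure Ω} [IsProbabilityMeasure P] {P' : Measure Ω'} [IsProbabilityMeasure P']
    {P₀ : Measure Ω₀} [IsProbabilityMeasure P₀]
    {ξ : Ω₀ → E} (hξ : Measurable ξ) (hξs : ∀ w, ξ w ∈ s)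
    {Z : ℕ → Ω → E} (hZ : ∀ n, Measurable (Z n))
    (hconv : ∀ g : E → ℝ, Continuous g → (∃ C, ∀ y, |g y| ≤ C) → Measurable g →
      Tendsto (fun n => ∫ w, g (Z n w) ∂P) atTop (𝓝 (∫ w, g (ξ w) ∂P₀)))
    {Y W : ℕ → Ω × Ω' → E} (hY : ∀ n, Measurable (Y n)) (hW : ∀ n, Measurable (W n))
    (hWYZ : ∀ n p, W n p = Y n p + Z n p.1)
    (hboot : ∀ δ : ℝ, 0 < δ → Tendsto (fun n => P.real {w |
      δ ≤ dBL (Measure.map (fun w' => Y n (w, w')) P') (Measure.map ξ P₀)}) atTop (𝓝 0))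
    {g : E → ℝ} {L : ℝ} (hg : Measurable g) (hL : 0 < L) (hgb : ∀ x, |g x| ≤ L)
    (hglip : ∀ x y, |g x - g y| ≤ L * dist x y) :
    Tendsto (fun n => ∫ p, g (W n p) ∂(P.prod P')) atTop
      (𝓝 (∫ p, g (ξ p.1 + ξ p.2) ∂(P₀.prod P₀))) := by
  have hadd := measurable_add_of_isSeparable hmE hs hξ hξs
  have hgcont : Continuous g := by
    refine LipschitzWith.continuous (K := ⟨L, hL.le⟩) (LipschitzWith.of_dist_le_mul fun x y => ?_)
    rw [Real.dist_eq]
    exact hglip x y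
  set G : E → ℝ := fun x => ∫ w, g (x + ξ w) ∂P₀ with hG
  set A : ℕ → Ω → ℝ := fun n w => ∫ w', g (W n (w, w')) ∂P' with hA
  have hGm : Measurable G :=
    (StronglyMeasurable.integral_prod_right (f := fun x w => g (x + ξ w))
      (hg.comp hadd).stronglyMeasurable).measurable
  have hAm : ∀ n, Measurable (A n) := fun n =>
    (StronglyMeasurable.integral_prod_right (f := fun w w' => g (W n (w, w')))
      (hg.comp (hW n)).stronglyMeasurable).measurable
  have hGb : ∀ x, |G x| ≤ L := fun x => by
    simpa using norm_integral_le_of_norm_le_const (μ := P₀) (f := fun w => g (x + ξ w)) (C := L)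
      (.of_forall fun w => hgb _)
  have hAb : ∀ n w, |A n w| ≤ L := fun n w => by
    simpa using norm_integral_le_of_norm_le_const (μ := P') (f := fun w' => g (W n (w, w')))
      (C := L) (.of_forall fun w => hgb _)
  have hGcont : Continuous G := by
    refine continuous_of_dominated (bound := fun _ => L) (fun x => ?_)
      (fun x => .of_forall fun w => hgb _) (integrable_const _)
      (.of_forall fun w => hgcont.comp (continuous_id.add continuous_const))
    exact (hg.comp (hadd.comp measurable_prodMk_left)).aestronglyMeasurable
  have hdiff : ∀ n w, |A n w - G (Z n w)| ≤
      L * dBL (Measure.map (fun w' => Y n (w, w')) P') (Measure.map ξ P₀) := by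
    intro n w
    have hYw : Measurable fun w' => Y n (w, w') := (hY n).comp measurable_prodMk_left
    have htrans : Measurable fun x => g (x + Z n w) := by
      have := measurable_add_of_isSeparable hmE (Set.finite_singleton (Z n w)).isSeparable
        (ξ := fun _ : Unit => Z n w) measurable_const (fun _ => rfl)
      exact hg.comp (this.comp (measurable_id.prodMk (measurable_const (a := ()))))
    have : IsProbabilityMeasure (Measure.map (fun w' => Y n (w, w')) P') :=
      Measure.isProbabilityMeasure_map hYw.aemeasurable
    have : IsProbabilityMeasure (Measure.map ξ P₀) :=
      Measure.isProbabilityMeasure_map hξ.aemeasurable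
    have h := abs_integral_sub_integral_le_dBL (μ := Measure.map (fun w' => Y n (w, w')) P')
      (ν := Measure.map ξ P₀) htrans hL (fun x => hgb _)
      (fun x y => (hglip _ _).trans_eq (by rw [dist_add_right]))
    rw [integral_map hYw.aemeasurable htrans.aestronglyMeasurable,
      integral_map hξ.aemeasurable htrans.aestronglyMeasurable] at h
    simpa only [hA, hG, hWYZ, add_comm (Z n w)] using h
  have hGZm : ∀ n, Measurable fun w => G (Z n w) := fun n => hGm.comp (hZ n)
  have hlim := tendsto_integral_abs_of_tendsto_measureReal (μ := P)
    (h := fun n w => A n w - G (Z n w)) (C := L + L) (fun n => (hAm n).sub (hGZm n))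
    (fun n w => (abs_sub _ _).trans (add_le_add (hAb n w) (hGb _))) (by
      intro ε hε
      refine squeeze_zero (fun _ => measureReal_nonneg) (fun n => measureReal_mono ?_)
        (hboot (ε / L) (div_pos hε hL))
      intro w hw
      exact (div_le_iff₀' hL).2 (le_trans hw (hdiff n w)))
  have hAint : ∀ n, Integrable (A n) P := fun n =>
    .of_bound (hAm n).aestronglyMeasurable L (.of_forall (hAb n))
  have hGint : ∀ n, Integrable (fun w => G (Z n w)) P := fun n =>
    .of_bound (hGZm n).aestronglyMeasurable L (.of_forall fun w => hGb _)
  have h0 : Tendsto (fun n => ∫ w, A n w - G (Z n w) ∂P) atTop (𝓝 0) :=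
    squeeze_zero_norm (fun n => norm_integral_le_integral_norm _) hlim
  have hsum := h0.add (hconv G hGcont ⟨L, hGb⟩ hGm)
  have hlimit : ∫ p, g (ξ p.1 + ξ p.2) ∂(P₀.prod P₀) = ∫ w, G (ξ w) ∂P₀ := by
    refine integral_prod _ (.of_bound ?_ L (.of_forall fun p => hgb _))
    exact (hg.comp (hadd.comp ((hξ.comp measurable_fst).prodMk
      measurable_snd))).aestronglyMeasurable
  rw [hlimit]
  rw [zero_add] at hsum
  refine hsum.congr fun n => ?_
  rw [integral_sub (hAint n) (hGint n), sub_add_cancel]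
  exact (integral_prod _ (.of_bound (hg.comp (hW n)).aestronglyMeasurable L
    (.of_forall fun p => hgb _))).symm

/-- **Delta-method for the bootstrap, outer-probability version** (Theorem 3.1(iii)).
The ambient vector space `V` contains the normed space `E` as a linear subspace; this
is modelled by an injective linear map `ι : E →ₗ[ℝ] V`.  "`a_n(T̂_n − θ)` takes values
only in `E`" is expressed by exhibiting maps `Z n : Ω → E` (resp. `Zstar`, `Zstarθ`)
with `ι ∘ Z n = a_n(T̂_n − θ)` etc. -/
theorem bootstrap_delta_method_outer
    {V : Type*} [AddCommGroup V] [Module ℝ V]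
    {E : Type*} [NormedAddCommGroup E] [NormedSpace ℝ E]
    (ι : E →ₗ[ℝ] V) (hι : Function.Injective ι)
    {F : Type*} [NormedAddCommGroup F] [NormedSpace ℝ F]
    [TopologicalSpace.SeparableSpace F] [mF : MeasurableSpace F] [BorelSpace F]
    [mE : MeasurableSpace E] (hmE : mE = ballSigma E)
    (E₀ : Submodule ℝ E) (hE₀sep : TopologicalSpace.IsSeparable (E₀ : Set E))
    (hE₀meas : MeasurableSet (E₀ : Set E))
    (Vf : Set V) (f : V → F) (θ : V) (hθ : θ ∈ Vf)
    (a : ℕ → ℝ) (ha_pos : ∀ n, 0 < a n) (ha_top : Tendsto a atTop atTop)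
    {Ω Ω' : Type*} [MeasurableSpace Ω] [MeasurableSpace Ω']
    (P : Measure Ω) [IsProbabilityMeasure P] (P' : Measure Ω') [IsProbabilityMeasure P']
    (T : ℕ → Ω → V) (hT : ∀ n ω, T n ω ∈ Vf)
    (Tstar : ℕ → Ω × Ω' → V) (hTstar : ∀ n p, Tstar n p ∈ Vf)
    -- (a) `a_n(T̂_n − θ)` takes values only in `E`, is measurable, and converges in
    -- distribution° to ξ, which takes values in E₀
    (Z : ℕ → Ω → E) (hZ : ∀ n ω, ι (Z n ω) = a n • (T n ω - θ))
    (hZmeas : ∀ n, Measurable (Z n))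
    {Ω₀ : Type*} [MeasurableSpace Ω₀] (P₀ : Measure Ω₀) [IsProbabilityMeasure P₀]
    (ξ : Ω₀ → E) (hξmeas : Measurable ξ) (hξmem : ∀ ω₀, ξ ω₀ ∈ E₀)
    (hconv : ∀ g : E → ℝ, Continuous g → (∃ C, ∀ y, |g y| ≤ C) → Measurable g →
      Tendsto (fun n => ∫ ω, g (Z n ω) ∂P) atTop (𝓝 (∫ ω₀, g (ξ ω₀) ∂P₀)))
    -- (b) `f(T̂_n)` is measurable
    (hfmeas : ∀ n, Measurable fun ω => f (T n ω))
    -- (c) `f` is quasi-Hadamard differentiable at `θ` tangentially to `E₀⟨E⟩` with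
    -- derivative `f'` (a continuous map on `E₀`, modelled as a total map `E → F`)
    (f' : E → F) (hf'cont : ContinuousOn f' (E₀ : Set E))
    (hqH : ∀ x₀ ∈ E₀, ∀ xs : ℕ → E, ∀ εs : ℕ → ℝ,
      (∀ n, 0 < εs n) → Tendsto εs atTop (𝓝 0) →
      Tendsto (fun n => ‖xs n - x₀‖) atTop (𝓝 0) →
      (∀ n, θ + εs n • ι (xs n) ∈ Vf) →
      Tendsto (fun n => ‖f' x₀ - (εs n)⁻¹ • (f (θ + εs n • ι (xs n)) - f θ)‖) atTop (𝓝 0))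
    -- (d) the extension `f' : E → F` is linear, measurable, and continuous at points of E₀
    (hf'lin : IsLinearMap ℝ f') (hf'meas : Measurable f')
    (hf'contAt : ∀ y ∈ E₀, ContinuousAt f' y)
    -- (e) `f(T̂_n*)` is measurable
    (hfstarmeas : ∀ n, Measurable fun p : Ω × Ω' => f (Tstar n p))
    -- (f) `a_n(T̂_n* − θ)` and `a_n(T̂_n* − T̂_n)` take values only in `E`, are measurable,
    -- and `(T̂_n*)` is almost surely a bootstrap version of `(T̂_n)`
    (Zstarθ : ℕ → Ω × Ω' → E) (hZstarθ : ∀ n p, ι (Zstarθ n p) = a n • (Tstar n p - θ))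
    (hZstarθmeas : ∀ n, Measurable (Zstarθ n))
    (Zstar : ℕ → Ω × Ω' → E) (hZstar : ∀ n p, ι (Zstar n p) = a n • (Tstar n p - T n p.1))
    (hZstarmeas : ∀ n, Measurable (Zstar n))
    -- (f') `(T̂_n*)` is a bootstrap version in outer probability of `(T̂_n)`.
    -- Here `P S` applied to a (possibly non-measurable) set is the outer measure of `S`,
    -- which coincides with the outer probability `inf {P A : A ∈ ℱ, S ⊆ A}`.
    (hboot' : ∀ δ : ℝ, 0 < δ →
      Tendsto (fun n => P {ω |
          δ ≤ dBL (Measure.map (fun ω' => Zstar n (ω, ω')) P') (Measure.map ξ P₀)})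
        atTop (𝓝 0)) :
    -- conclusions
    (∀ n, Measurable fun p : Ω × Ω' => a n • (f (Tstar n p) - f (T n p.1))) ∧
    Measurable (fun ω₀ => f' (ξ ω₀)) ∧
    ∀ δ : ℝ, 0 < δ →
      Tendsto (fun n => P {ω |
          δ ≤ dBL (Measure.map (fun ω' => a n • (f (Tstar n (ω, ω')) - f (T n ω))) P')
                (Measure.map (fun ω₀ => f' (ξ ω₀)) P₀)})
        atTop (𝓝 0) := by
  have hf'Z : ∀ n, Measurable fun p => f' (Zstar n p) := fun n => hf'meas.comp (hZstarmeas n)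
  have hdiffmeas : ∀ n, Measurable fun p : Ω × Ω' => a n • (f (Tstar n p) - f (T n p.1)) :=
    fun n => ((hfstarmeas n).sub ((hfmeas n).comp measurable_fst)).const_smul (a n)
  refine ⟨hdiffmeas, hf'meas.comp hξmeas, fun δ hδ => ?_⟩
  have hboot : ∀ δ : ℝ, 0 < δ → Tendsto (fun n => P.real {ω |
      δ ≤ dBL (Measure.map (fun ω' => Zstar n (ω, ω')) P') (Measure.map ξ P₀)}) atTop (𝓝 0) :=
    fun δ hδ => (ENNReal.tendsto_toReal ENNReal.zero_ne_top).comp (hboot' δ hδ)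
  let A : E →L[ℝ] F := ⟨hf'lin.mk' f', continuous_of_continuousAt_zero (hf'lin.mk' f')
    (hf'contAt 0 E₀.zero_mem)⟩
  obtain ⟨L, hL1, hL⟩ : ∃ L : ℝ, 1 ≤ L ∧ ∀ x y, ‖f' x - f' y‖ ≤ L * dist x y := by
    refine ⟨max 1 ‖A‖, le_max_left _ _, fun x y => ?_⟩
    rw [dist_eq_norm]
    calc ‖f' x - f' y‖ = ‖A (x - y)‖ := by rw [map_sub]; rfl
      _ ≤ ‖A‖ * ‖x - y‖ := A.le_opNorm _
      _ ≤ _ := by gcongr; exact le_max_right _ _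
  have hL0 : 0 < L := one_pos.trans_le hL1
  have hsum : ∀ n p, Zstarθ n p = Zstar n p + Z n p.1 := fun n p => hι (by
    rw [map_add, hZstarθ, hZstar, hZ, ← smul_add, sub_add_sub_cancel])
  have hTeq : ∀ n ω, θ + (a n)⁻¹ • ι (Z n ω) = T n ω := fun n ω => by
    rw [hZ, inv_smul_smul₀ (ha_pos n).ne', add_sub_cancel]
  have hTstareq : ∀ n p, θ + (a n)⁻¹ • ι (Zstarθ n p) = Tstar n p := fun n p => by
    rw [hZstarθ, inv_smul_smul₀ (ha_pos n).ne', add_sub_cancel]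
  have hLipCont : ∀ {g : E → ℝ} {K : ℝ}, 0 < K → (∀ x y, |g x - g y| ≤ K * dist x y) →
      Continuous g := fun {g K} hK hg =>
    LipschitzWith.continuous (K := ⟨K, hK.le⟩) (LipschitzWith.of_dist_le_mul fun x y => by
      rw [Real.dist_eq]; exact hg x y)
  -- the two remainders vanish in probability
  let B : ℝ → ℕ → Set E := fun ε n => {x | θ + (a n)⁻¹ • ι x ∈ Vf ∧
    ε ≤ ‖a n • (f (θ + (a n)⁻¹ • ι x) - f θ) - f' x‖}
  have hB : ∀ ε : ℝ, 0 < ε → ∀ x₀ ∈ (E₀ : Set E), ∃ δ : ℝ, 0 < δ ∧ ∃ N : ℕ, ∀ n, N ≤ n →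
      ∀ x, dist x x₀ < δ → x ∉ B ε n := fun ε hε x₀ hx₀ =>
    exists_locally_small_remainder_of_quasiHadamard ha_pos ha_top (hqH x₀ hx₀)
      (hf'contAt x₀ hx₀) hε
  have hZB : ∀ ε : ℝ, 0 < ε →
      Tendsto (fun n => (P.prod P').real {p | Z n p.1 ∈ B ε n}) atTop (𝓝 0) := by
    intro ε hε
    refine tendsto_measureReal_mem_of_locally_avoid hmE hE₀sep (ν := P₀)
      (μ := P.prod P')
      (X := fun n p => Z n p.1) (B := B ε) (fun n => (hZmeas n).comp measurable_fst) hξmeas hξmem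
      ?_ (hB ε hε)
    intro g K hg hK hgb hglip
    have hfst : ∀ n, ∫ p, g (Z n p.1) ∂(P.prod P') = ∫ ω, g (Z n ω) ∂P := fun n => by
      rw [integral_fun_fst (fun ω => g (Z n ω)), probReal_univ, one_smul]
    simpa only [hfst] using hconv g (hLipCont hK hglip) ⟨K, hgb⟩ hg
  have hZstarB : ∀ ε : ℝ, 0 < ε →
      Tendsto (fun n => (P.prod P').real {p | Zstarθ n p ∈ B ε n}) atTop (𝓝 0) := by
    intro ε hε
    refine tendsto_measureReal_mem_of_locally_avoid hmE hE₀sep (μ := P.prod P')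
      (ν := P₀.prod P₀) (B := B ε) hZstarθmeas (η := fun p => ξ p.1 + ξ p.2) ?_ (fun p => E₀.add_mem (hξmem _) (hξmem _)) ?_
      (hB ε hε)
    · exact (measurable_add_of_isSeparable hmE hE₀sep hξmeas hξmem).comp
        ((hξmeas.comp measurable_fst).prodMk measurable_snd)
    · intro g K hg hK hgb hglip
      exact tendsto_integral_add_of_tendsto_conditional_dBL hmE hE₀sep hξmeas hξmem hZmeas hconv
        hZstarmeas hZstarθmeas hsum hboot hg hK hgb hglip
  let D : ℕ → Ω × Ω' → ℝ := fun n p =>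
    min 2 ‖a n • (f (Tstar n p) - f (T n p.1)) - f' (Zstar n p)‖
  have hD0 : ∀ n p, 0 ≤ D n p := fun n p => le_min zero_le_two (norm_nonneg _)
  have hD2 : ∀ n p, |D n p| ≤ 2 := fun n p => by
    rw [abs_of_nonneg (hD0 n p)]; exact min_le_left _ _
  have hDm : ∀ n, Measurable (D n) := fun n =>
    measurable_const.min ((hdiffmeas n).sub (hf'Z n)).norm
  have hDle : ∀ n p, D n p ≤ ‖a n • (f (Tstar n p) - f θ) - f' (Zstarθ n p)‖ +
      ‖a n • (f (T n p.1) - f θ) - f' (Z n p.1)‖ := fun n p => by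
    refine (min_le_right _ _).trans (le_trans (le_of_eq ?_) (norm_sub_le _ _))
    rw [hsum, hf'lin.map_add]
    congr 1
    module
  have hDlim : Tendsto (fun n => ∫ p, D n p ∂(P.prod P')) atTop (𝓝 0) := by
    have h := tendsto_integral_abs_of_tendsto_measureReal (μ := P.prod P') hDm hD2 (by
      intro ε hε
      have hadd := (hZstarB (ε / 2) (half_pos hε)).add (hZB (ε / 2) (half_pos hε))
      rw [add_zero] at hadd
      refine squeeze_zero (fun _ => measureReal_nonneg) (fun n => ?_) hadd
      refine (measureReal_mono ?_).trans (measureReal_union_le _ _)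
      intro p hp
      rw [Set.mem_ofPred_eq, abs_of_nonneg (hD0 n p)] at hp
      have hle := hp.trans (hDle n p)
      by_contra hnot
      simp only [B, Set.mem_union, Set.mem_ofPred_eq, hTeq, hTstareq, hT, hTstar, true_and,
        not_or, not_le] at hnot
      linarith [hnot.1, hnot.2])
    simpa only [abs_of_nonneg (hD0 _ _)] using h
  let H : ℕ → Ω → ℝ := fun n ω => ∫ ω', D n (ω, ω') ∂P'
  have hH0 : ∀ n ω, 0 ≤ H n ω := fun n ω => integral_nonneg fun ω' => hD0 n _
  have hDint : ∀ n, Integrable (D n) (P.prod P') := fun n =>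
    .of_bound (hDm n).aestronglyMeasurable 2 (.of_forall (hD2 n))
  have hHlim : Tendsto (fun n => P.real {ω | δ / 2 ≤ H n ω}) atTop (𝓝 0) := by
    have h := hDlim.const_mul (δ / 2)⁻¹
    rw [mul_zero] at h
    refine squeeze_zero (fun _ => measureReal_nonneg) (fun n => ?_) h
    rw [le_inv_mul_iff₀ (half_pos hδ), integral_prod _ (hDint n)]
    exact mul_meas_ge_le_integral_of_nonneg (.of_forall (hH0 n)) (hDint n).integral_prod_left _
  have hbound : ∀ n ω, dBL (Measure.map (fun ω' => a n • (f (Tstar n (ω, ω')) - f (T n ω))) P')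
      (Measure.map (fun ω₀ => f' (ξ ω₀)) P₀) ≤
      H n ω + L * dBL (Measure.map (fun ω' => Zstar n (ω, ω')) P') (Measure.map ξ P₀) := by
    intro n ω
    have hYm : Measurable fun ω' => a n • (f (Tstar n (ω, ω')) - f (T n ω)) :=
      (hdiffmeas n).comp measurable_prodMk_left
    have hZm : Measurable fun ω' => Zstar n (ω, ω') :=
      (hZstarmeas n).comp measurable_prodMk_left
    have hξ'm : Measurable fun ω₀ => f' (ξ ω₀) := hf'meas.comp hξmeas
    have : IsProbabilityMeasure (Measure.map (fun ω' => Zstar n (ω, ω')) P') :=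
      Measure.isProbabilityMeasure_map hZm.aemeasurable
    have : IsProbabilityMeasure (Measure.map ξ P₀) :=
      Measure.isProbabilityMeasure_map hξmeas.aemeasurable
    refine dBL_le fun g hg hgb hglip => ?_
    have hgf : Measurable fun x => g (f' x) := hg.comp hf'meas
    have h2 := abs_integral_sub_integral_le_dBL
      (μ := Measure.map (fun ω' => Zstar n (ω, ω')) P') (ν := Measure.map ξ P₀)
      hgf hL0 (fun x => (hgb _).trans hL1)
      (fun x y => (hglip _ _).trans (by rw [dist_eq_norm]; exact hL x y))
    rw [integral_map hZm.aemeasurable hgf.aestronglyMeasurable,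
      integral_map hξmeas.aemeasurable hgf.aestronglyMeasurable] at h2
    rw [integral_map hYm.aemeasurable hg.aestronglyMeasurable,
      integral_map hξ'm.aemeasurable hg.aestronglyMeasurable]
    have hi1 : Integrable (fun ω' => g (a n • (f (Tstar n (ω, ω')) - f (T n ω)))) P' :=
      .of_bound (hg.comp hYm).aestronglyMeasurable 1 (.of_forall fun _ => hgb _)
    have hi2 : Integrable (fun ω' => g (f' (Zstar n (ω, ω')))) P' :=
      .of_bound (hgf.comp hZm).aestronglyMeasurable 1 (.of_forall fun _ => hgb _)
    have hi3 : Integrable (fun ω' => D n (ω, ω')) P' :=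
      .of_bound ((hDm n).comp measurable_prodMk_left).aestronglyMeasurable 2
        (.of_forall fun _ => hD2 n _)
    have h1 : |∫ ω', g (a n • (f (Tstar n (ω, ω')) - f (T n ω))) ∂P' -
        ∫ ω', g (f' (Zstar n (ω, ω'))) ∂P'| ≤ H n ω := by
      rw [← integral_sub hi1 hi2]
      refine abs_integral_le_integral_abs.trans (integral_mono (hi1.sub hi2).abs hi3 fun ω' => ?_)
      refine le_min ?_ ((hglip _ _).trans_eq (dist_eq_norm _ _))
      exact (abs_sub _ _).trans ((add_le_add (hgb _) (hgb _)).trans_eq one_add_one_eq_two)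
    exact (abs_sub_le _ _ _).trans (add_le_add h1 h2)
  have hreal : Tendsto (fun n => P.real {ω |
      δ ≤ dBL (Measure.map (fun ω' => a n • (f (Tstar n (ω, ω')) - f (T n ω))) P')
        (Measure.map (fun ω₀ => f' (ξ ω₀)) P₀)}) atTop (𝓝 0) := by
    have hadd := hHlim.add (hboot (δ / 2 / L) (div_pos (half_pos hδ) hL0))
    rw [add_zero] at hadd
    refine squeeze_zero (fun _ => measureReal_nonneg) (fun n => ?_) hadd
    refine (measureReal_mono ?_).trans (measureReal_union_le _ _)
    intro ω hω
    have hle := le_trans hω (hbound n ω)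
    by_contra hnot
    simp only [Set.mem_union, Set.mem_ofPred_eq, not_or, not_le] at hnot
    have := (lt_div_iff₀' hL0).1 hnot.2
    linarith [hnot.1]
  exact (ENNReal.tendsto_toReal_iff (fun _ => measure_ne_top _ _) ENNReal.zero_ne_top).1 hreal
end

section
/- Extended Continuous Mapping theorem for the open-ball σ-algebra (Theorem D.2): Let (E,d) and (Ẽ,d̃) be metric spaces with open-ball σ-algebras ℬ° and ℬ̃°. For each n ≥ 1, let E_n ⊆ E and let ξ_n be an (E,ℬ°)-valued random variable on a probability space (Ω_n,ℱ_n,ℙ_n) with ξ_n(Ω_n) ⊆ E_n; let ξ₀ be an (E,ℬ°)-valued random variable on (Ω₀,ℱ₀,ℙ₀) with ξ₀(Ω₀) ⊆ E₀ for some separable set E₀ ∈ ℬ°. Let h_n : E_n → Ẽ be maps such that h_n(ξ_n) : Ω_n → Ẽ is (ℱ_n,ℬ̃°)-measurable for every n ≥ 1, and let h₀ : E₀ → Ẽ be measurable from the trace σ-algebra ℬ₀° := {A ∩ E₀ : A ∈ ℬ°} to ℬ̃°. Assume: (a) ξ_n converges in distribution° to ξ₀; (b) for all x_n ∈ E_n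 (n ≥ 1) and x₀ ∈ E₀ with d(x_n,x₀) → 0 one has d̃(h_n(x_n),h₀(x₀)) → 0. Then h_n(ξ_n) converges in distribution° to h₀(ξ₀), i.e. ∫ g(h_n(ξ_n)) dℙ_n → ∫ g(h₀(ξ₀)) dℙ₀ for every bounded, continuous, (ℬ̃°,Borel(ℝ))-measurable g : Ẽ → ℝ. -/
open MeasureTheory Filter Topology

/-- A tent-like function equal to `1` near `z` and vanishing off `ball z (1 / (k + 1))`. -/
noncomputable def ballBump {E : Type*} [PseudoMetricSpace E] (z : E) (k : ℕ) (x : E) : ℝ :=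
  max 0 (min 1 (2 - 2 * ((k : ℝ) + 1) * dist x z))

section ballBump

variable {E : Type*} [PseudoMetricSpace E] (z : E) (k : ℕ)

lemma ballBump_nonneg (x : E) : 0 ≤ ballBump z k x := le_max_left _ _

lemma ballBump_le_one (x : E) : ballBump z k x ≤ 1 :=
  max_le zero_le_one (min_le_left _ _)

lemma continuous_ballBump : Continuous (ballBump z k) := by
  unfold ballBump
  fun_prop

variable {z k}

lemma ballBump_eq_zero {x : E} (hx : 1 / ((k : ℝ) + 1) ≤ dist x z) : ballBump z k x = 0 := by
  have hk : (0 : ℝ) < k + 1 := by positivity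
  rw [div_le_iff₀ hk] at hx
  exact max_eq_left ((min_le_right _ _).trans (by linarith))

lemma ballBump_eq_one {x : E} (hx : dist x z < 1 / (2 * ((k : ℝ) + 1))) :
    ballBump z k x = 1 := by
  have hk : (0 : ℝ) < 2 * ((k : ℝ) + 1) := by positivity
  rw [lt_div_iff₀ hk] at hx
  unfold ballBump
  rw [min_eq_left (by linarith), max_eq_right zero_le_one]

end ballBump

lemma measurable_dist_of_eq_ballSigma {E : Type*} [PseudoMetricSpace E] [mE : MeasurableSpace E]
    (hmE : mE = ballSigma E) (z : E) : Measurable fun x => dist x z := by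
  refine measurable_of_Iio fun r => ?_
  rcases le_or_gt r 0 with hr | hr
  · convert MeasurableSet.empty
    ext x
    simpa using hr.trans dist_nonneg
  · rw [hmE]
    exact MeasurableSpace.measurableSet_generateFrom ⟨z, r, hr, rfl⟩

lemma measurable_ballBump {E : Type*} [PseudoMetricSpace E] [mE : MeasurableSpace E]
    (hmE : mE = ballSigma E) (z : E) (k : ℕ) : Measurable (ballBump z k) := by
  have := measurable_dist_of_eq_ballSigma hmE z
  unfold ballBump
  fun_prop

lemma exists_seq_mem_tendsto {E : Type*} [PseudoMetricSpace E] {A : ℕ → Set E}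
    (hA : ∀ n, (A n).Nonempty) {x : E}
    (hx : ∀ r > 0, ∀ᶠ n in atTop, ∃ y ∈ A n, dist y x < r) :
    ∃ s : ℕ → E, (∀ n, s n ∈ A n) ∧ Tendsto (fun n => dist (s n) x) atTop (𝓝 0) := by
  have hnear : ∀ n : ℕ, ∃ y ∈ A n, dist x y < Metric.infDist x (A n) + 1 / ((n : ℝ) + 1) :=
    fun n => (Metric.infDist_lt_iff (hA n)).1 (lt_add_of_pos_right _ (by positivity))
  choose s hsA hs using hnear
  have hinf : Tendsto (fun n => Metric.infDist x (A n)) atTop (𝓝 0) := by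
    rw [tendsto_order]
    refine ⟨fun a ha => .of_forall fun n => ha.trans_le Metric.infDist_nonneg, fun r hr => ?_⟩
    filter_upwards [hx r hr] with n ⟨y, hy, hyr⟩
    exact (Metric.infDist_le_dist_of_mem hy).trans_lt (by rwa [dist_comm])
  refine ⟨s, hsA, squeeze_zero (fun n => dist_nonneg) (fun n => ?_)
    (by simpa using hinf.add tendsto_one_div_add_atTop_nhds_zero_nat)⟩
  rw [dist_comm]
  simpa using (hs n).le

/-- Convergence along full sequences in the sets `A n` gives a lower bound which is uniform over
late indices and nearby points, provided the limit point can be approached at all. -/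
lemma exists_uniform_lower_bound {E : Type*} [PseudoMetricSpace E] {A : ℕ → Set E}
    {φ : ℕ → E → ℝ} {x : E} {a : ℝ}
    (hφ : ∀ s : ℕ → E, (∀ n, s n ∈ A n) → Tendsto (fun n => dist (s n) x) atTop (𝓝 0) →
      Tendsto (fun n => φ n (s n)) atTop (𝓝 a))
    {s : ℕ → E} (hsA : ∀ n, s n ∈ A n) (hs : Tendsto (fun n => dist (s n) x) atTop (𝓝 0))
    {b : ℝ} (hb : b < a) :
    ∃ k : ℕ, ∀ n ≥ k, ∀ y ∈ A n, dist y x < 1 / ((k : ℝ) + 1) → b ≤ φ n y := by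
  classical
  by_contra! hcon
  have hfreq : ∀ k : ℕ, ∃ᶠ n in atTop, ∃ y ∈ A n, dist y x < 1 / ((k : ℝ) + 1) ∧ φ n y < b := by
    intro k
    rw [frequently_atTop]
    intro N
    obtain ⟨n, hn, y, hy, hyx, hlt⟩ := hcon (max k N)
    refine ⟨n, (le_max_right _ _).trans hn, y, hy, hyx.trans_le ?_, hlt⟩
    exact one_div_le_one_div_of_le (by positivity) (by simp)
  obtain ⟨e, he, hbad⟩ := extraction_forall_of_frequently hfreq
  choose y hyA hyx hyb using hbad
  have hmix : ∀ n, ∃ w ∈ A n,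
      (∀ k, e k = n → dist w x < 1 / ((k : ℝ) + 1) ∧ φ n w < b) ∧
      ((∀ k, e k ≠ n) → w = s n) := by
    intro n
    by_cases hn : ∃ k, e k = n
    · obtain ⟨k, rfl⟩ := hn
      refine ⟨y k, hyA k, fun j hj => ?_, fun hne => absurd rfl (hne k)⟩
      rw [he.injective hj]
      exact ⟨hyx k, hyb k⟩
    · push Not at hn
      exact ⟨s n, hsA n, fun k hk => absurd hk (hn k), fun _ => rfl⟩
  choose w hwA hwbad hwgood using hmix
  have hw : Tendsto (fun n => dist (w n) x) atTop (𝓝 0) := by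
    rw [tendsto_order]
    refine ⟨fun c hc => .of_forall fun n => hc.trans_le dist_nonneg, fun r hr => ?_⟩
    obtain ⟨K, hK⟩ := exists_nat_one_div_lt hr
    filter_upwards [hs.eventually_lt_const hr, eventually_ge_atTop (e K)] with n hsn hn
    by_cases hk : ∃ k, e k = n
    · obtain ⟨k, rfl⟩ := hk
      have hKk : (K : ℝ) ≤ k := by exact_mod_cast he.le_iff_le.1 hn
      refine ((hwbad _ k rfl).1.trans_le ?_).trans hK
      exact one_div_le_one_div_of_le (by positivity) (by linarith)
    · push Not at hk
      rwa [hwgood n hk]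
  have hlim := (hφ w hwA hw).comp he.tendsto_atTop
  exact hb.not_ge (le_of_tendsto hlim (.of_forall fun k => (hwbad _ k rfl).2.le))

/-- Almost surely, the limit variable can be approached by points of the sets in which the
converging variables take their values. -/
lemma ae_exists_seq_tendsto {E : Type*} [PseudoMetricSpace E] [mE : MeasurableSpace E]
    (hmE : mE = ballSigma E) {Ω : ℕ → Type*} [∀ n, MeasurableSpace (Ω n)]
    (P : ∀ n, Measure (Ω n)) {Ω₀ : Type*} [MeasurableSpace Ω₀] (P₀ : Measure Ω₀)
    [IsProbabilityMeasure P₀] {A : ℕ → Set E} (hA : ∀ n, (A n).Nonempty)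
    {ξ : ∀ n, Ω n → E} (hξA : ∀ n ω, ξ n ω ∈ A n)
    {ξ₀ : Ω₀ → E} (hξ₀ : Measurable ξ₀)
    (hconv : ∀ f : E → ℝ, Continuous f → (∃ C, ∀ x, |f x| ≤ C) → Measurable f →
      Tendsto (fun n => ∫ ω, f (ξ n ω) ∂(P n)) atTop (𝓝 (∫ ω₀, f (ξ₀ ω₀) ∂P₀)))
    {z : ℕ → E} (hz : ∀ ω, ξ₀ ω ∈ closure (Set.range z)) :
    ∀ᵐ ω ∂P₀, ∃ s : ℕ → E, (∀ n, s n ∈ A n) ∧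
      Tendsto (fun n => dist (s n) (ξ₀ ω)) atTop (𝓝 0) := by
  have hball : ∀ i k : ℕ, ∀ᵐ ω ∂P₀, dist (ξ₀ ω) (z i) < 1 / (2 * ((k : ℝ) + 1)) →
      ∀ᶠ n in atTop, ∃ y ∈ A n, dist y (z i) < 1 / ((k : ℝ) + 1) := by
    intro i k
    by_cases hev : ∀ᶠ n in atTop, ∃ y ∈ A n, dist y (z i) < 1 / ((k : ℝ) + 1)
    · exact .of_forall fun _ _ => hev
    have hlim := hconv (ballBump (z i) k) (continuous_ballBump _ _)
      ⟨1, fun x => abs_le.2 ⟨by linarith [ballBump_nonneg (z i) k x], ballBump_le_one _ _ x⟩⟩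
      (measurable_ballBump hmE _ _)
    have hzero : ∫ ω, ballBump (z i) k (ξ₀ ω) ∂P₀ = 0 := by
      by_contra hne
      refine hev ((hlim.eventually_ne hne).mono fun n hn => ?_)
      by_contra! hfar
      exact hn (by simp [fun ω => ballBump_eq_zero (hfar _ (hξA n ω))])
    have hint : Integrable (fun ω => ballBump (z i) k (ξ₀ ω)) P₀ :=
      .of_bound ((measurable_ballBump hmE _ _).comp hξ₀).aestronglyMeasurable 1
        (.of_forall fun ω => by
          rw [Real.norm_of_nonneg (ballBump_nonneg _ _ _)]
          exact ballBump_le_one _ _ _)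
    filter_upwards [(integral_eq_zero_iff_of_nonneg (fun ω => ballBump_nonneg _ _ _) hint).1 hzero]
      with ω hω hlt
    have := ballBump_eq_one hlt
    simp_all
  filter_upwards [ae_all_iff.2 fun i => ae_all_iff.2 (hball i)] with ω hω
  refine exists_seq_mem_tendsto hA fun r hr => ?_
  obtain ⟨k, hk⟩ := exists_nat_one_div_lt (half_pos hr)
  have hk' : 1 / (2 * ((k : ℝ) + 1)) ≤ 1 / ((k : ℝ) + 1) :=
    one_div_le_one_div_of_le (by positivity) (by linarith [k.cast_nonneg (α := ℝ)])
  obtain ⟨_, ⟨i, rfl⟩, hi⟩ := Metric.mem_closure_iff.1 (hz ω) (1 / (2 * ((k : ℝ) + 1)))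
    (by positivity)
  filter_upwards [hω i k hi] with n ⟨y, hy, hyz⟩
  refine ⟨y, hy, ?_⟩
  have := dist_triangle_right y (ξ₀ ω) (z i)
  linarith

/-- Domination from below by continuous test functions that exhaust the limit function gives
asymptotic lower semicontinuity of the integrals. -/
lemma eventually_lt_integral_of_minorants {E : Type*} [TopologicalSpace E] [MeasurableSpace E]
    {Ω : ℕ → Type*} [∀ n, MeasurableSpace (Ω n)]
    (P : ∀ n, Measure (Ω n)) [∀ n, IsProbabilityMeasure (P n)]
    {Ω₀ : Type*} [MeasurableSpace Ω₀] (P₀ : Measure Ω₀) [IsProbabilityMeasure P₀]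
    {ξ : ∀ n, Ω n → E} (hξ : ∀ n, Measurable (ξ n)) {ξ₀ : Ω₀ → E} (hξ₀ : Measurable ξ₀)
    (hconv : ∀ f : E → ℝ, Continuous f → (∃ C, ∀ x, |f x| ≤ C) → Measurable f →
      Tendsto (fun n => ∫ ω, f (ξ n ω) ∂(P n)) atTop (𝓝 (∫ ω₀, f (ξ₀ ω₀) ∂P₀)))
    {φ : ∀ n, Ω n → ℝ} (hφ : ∀ n, Integrable (φ n) (P n))
    {φ₀ : Ω₀ → ℝ} (hφ₀ : Measurable φ₀) {C : ℝ} (hφ₀C : ∀ ω, |φ₀ ω| ≤ C)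
    {u : ℕ → E → ℝ} (hu : ∀ j, Continuous (u j)) (hum : ∀ j, Measurable (u j))
    (huC : ∀ j x, |u j x| ≤ C) (huφ : ∀ j, ∀ n ≥ j, ∀ ω, u j (ξ n ω) ≤ φ n ω)
    (huφ₀ : ∀ᵐ ω ∂P₀, ∀ b < φ₀ ω, ∃ j, b ≤ u j (ξ₀ ω)) {a : ℝ} (ha : a < ∫ ω, φ₀ ω ∂P₀) :
    ∀ᶠ n in atTop, a < ∫ ω, φ n ω ∂(P n) := by
  have hcont : ∀ m, Continuous (partialSups u m) := by
    intro m
    induction m with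
    | zero => simpa using hu 0
    | succ m ih => rw [partialSups_add_one]; exact ih.sup (hu _)
  have hmeas : ∀ m, Measurable (partialSups u m) := by
    intro m
    induction m with
    | zero => simpa using hum 0
    | succ m ih => rw [partialSups_add_one]; exact ih.sup (hum _)
  have hbdd : ∀ m x, |partialSups u m x| ≤ C := by
    intro m x
    induction m with
    | zero => simpa using huC 0 x
    | succ m ih =>
      rw [partialSups_add_one, Pi.sup_apply]
      exact abs_max_le_max_abs_abs.trans (max_le ih (huC _ x))
  have hint : ∀ m, Integrable (fun ω => partialSups u m (ξ₀ ω)) P₀ := fun m =>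
    .of_bound ((hmeas m).comp hξ₀).aestronglyMeasurable C (.of_forall fun ω => hbdd m _)
  have hlim : Tendsto (fun m => ∫ ω, min (partialSups u m (ξ₀ ω)) (φ₀ ω) ∂P₀) atTop
      (𝓝 (∫ ω, φ₀ ω ∂P₀)) := by
    refine tendsto_integral_of_dominated_convergence (fun _ => C)
      (fun m => (((hmeas m).comp hξ₀).min hφ₀).aestronglyMeasurable) (integrable_const _)
      (fun m => .of_forall fun ω => abs_min_le_max_abs_abs.trans (max_le (hbdd m _) (hφ₀C ω))) ?_
    filter_upwards [huφ₀] with ω hω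
    rw [tendsto_order]
    refine ⟨fun b hb => ?_, fun b hb => .of_forall fun m => (min_le_right _ _).trans_lt hb⟩
    obtain ⟨c, hbc, hc⟩ := exists_between hb
    obtain ⟨j, hj⟩ := hω c hc
    filter_upwards [eventually_ge_atTop j] with m hm
    exact lt_min ((hbc.trans_le hj).trans_le (le_partialSups_of_le u hm _)) hb
  obtain ⟨m, hm⟩ := (hlim.eventually_const_lt ha).exists
  have hm' : a < ∫ ω, partialSups u m (ξ₀ ω) ∂P₀ :=
    hm.trans_le <| integral_mono ((hint m).inf (.of_bound hφ₀.aestronglyMeasurable C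
      (.of_forall hφ₀C))) (hint m) fun ω => min_le_left _ _
  filter_upwards [(hconv _ (hcont m) ⟨C, hbdd m⟩ (hmeas m)).eventually_const_lt hm',
    eventually_ge_atTop m] with n hn hmn
  refine hn.trans_le (integral_mono (.of_bound ((hmeas m).comp (hξ n)).aestronglyMeasurable C
    (.of_forall fun ω => hbdd m _)) (hφ n) fun ω => ?_)
  have hle : ∀ l ≤ m, partialSups u l (ξ n ω) ≤ φ n ω := by
    intro l hl
    induction l with
    | zero => simpa using huφ 0 n (by omega) ω
    | succ l ih =>
      rw [partialSups_add_one, Pi.sup_apply]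
      exact max_le (ih (by omega)) (huφ _ n (by omega) ω)
  exact hle m le_rfl

lemma eventually_lt_integral_of_seq_tendsto {E : Type*} [PseudoMetricSpace E]
    [mE : MeasurableSpace E] (hmE : mE = ballSigma E)
    {Ω : ℕ → Type*} [∀ n, MeasurableSpace (Ω n)]
    (P : ∀ n, Measure (Ω n)) [∀ n, IsProbabilityMeasure (P n)]
    {Ω₀ : Type*} [MeasurableSpace Ω₀] (P₀ : Measure Ω₀) [IsProbabilityMeasure P₀]
    {A : ℕ → Set E} {A₀ : Set E} (hA₀ : TopologicalSpace.IsSeparable A₀)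
    {ξ : ∀ n, Ω n → E} (hξ : ∀ n, Measurable (ξ n)) (hξA : ∀ n ω, ξ n ω ∈ A n)
    {ξ₀ : Ω₀ → E} (hξ₀ : Measurable ξ₀) (hξ₀A : ∀ ω, ξ₀ ω ∈ A₀)
    (hconv : ∀ f : E → ℝ, Continuous f → (∃ C, ∀ x, |f x| ≤ C) → Measurable f →
      Tendsto (fun n => ∫ ω, f (ξ n ω) ∂(P n)) atTop (𝓝 (∫ ω₀, f (ξ₀ ω₀) ∂P₀)))
    {φ : ℕ → E → ℝ} (hφm : ∀ n, Measurable fun ω => φ n (ξ n ω))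
    {φ₀ : E → ℝ} (hφ₀m : Measurable fun ω => φ₀ (ξ₀ ω)) {C : ℝ}
    (hφ0 : ∀ n x, 0 ≤ φ n x) (hφC : ∀ n x, φ n x ≤ C) (hφ₀C : ∀ x, |φ₀ x| ≤ C)
    (hlim : ∀ (s : ℕ → E) (x : E), (∀ n, s n ∈ A n) → x ∈ A₀ →
      Tendsto (fun n => dist (s n) x) atTop (𝓝 0) →
      Tendsto (fun n => φ n (s n)) atTop (𝓝 (φ₀ x)))
    {a : ℝ} (ha : a < ∫ ω, φ₀ (ξ₀ ω) ∂P₀) :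
    ∀ᶠ n in atTop, a < ∫ ω, φ n (ξ n ω) ∂(P n) := by
  have hA : ∀ n, (A n).Nonempty := fun n =>
    let ⟨ω⟩ := (P n).nonempty_of_neZero
    ⟨_, hξA n ω⟩
  obtain ⟨ω₀⟩ := P₀.nonempty_of_neZero
  obtain ⟨c, hc, hAc⟩ := hA₀
  obtain ⟨z, rfl⟩ := hc.exists_eq_range (closure_nonempty_iff.1 ⟨_, hAc (hξ₀A ω₀)⟩)
  let V : ℕ → ℕ → Set ℝ := fun i k =>
    {v | ∃ n ≥ k, ∃ y ∈ A n, dist y (z i) < 1 / ((k : ℝ) + 1) ∧ φ n y = v}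
  have hV0 : ∀ i k, ∀ v ∈ V i k, 0 ≤ v := by
    rintro i k _ ⟨n, -, y, -, -, rfl⟩
    exact hφ0 n y
  have hc0 : ∀ i k, 0 ≤ sInf (V i k) := fun i k => Real.sInf_nonneg (hV0 i k)
  have hC : 0 ≤ C := (abs_nonneg _).trans (hφ₀C (ξ₀ ω₀))
  have hcC : ∀ i k, sInf (V i k) ≤ C := by
    intro i k
    rcases (V i k).eq_empty_or_nonempty with he | ⟨v, hv⟩
    · rwa [he, Real.sInf_empty]
    · refine (csInf_le ⟨0, hV0 i k⟩ hv).trans ?_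
      obtain ⟨n, -, y, -, -, rfl⟩ := hv
      exact hφC n y
  let u : ℕ → E → ℝ := fun j x =>
    sInf (V j.unpair.1 j.unpair.2) * ballBump (z j.unpair.1) j.unpair.2 x
  refine eventually_lt_integral_of_minorants P P₀ hξ hξ₀ hconv (u := u)
    (fun n => .of_bound (hφm n).aestronglyMeasurable C (.of_forall fun ω => ?_)) hφ₀m
    (fun ω => hφ₀C _) (fun j => continuous_const.mul (continuous_ballBump _ _))
    (fun j => (measurable_ballBump hmE _ _).const_mul _) (fun j x => ?_) (fun j n hn ω => ?_) ?_ ha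
  · rw [Real.norm_of_nonneg (hφ0 _ _)]
    exact hφC _ _
  · rw [abs_of_nonneg (mul_nonneg (hc0 _ _) (ballBump_nonneg _ _ _))]
    exact (mul_le_of_le_one_right (hc0 _ _) (ballBump_le_one _ _ _)).trans (hcC _ _)
  · by_cases hd : dist (ξ n ω) (z j.unpair.1) < 1 / ((j.unpair.2 : ℝ) + 1)
    · exact (mul_le_of_le_one_right (hc0 _ _) (ballBump_le_one _ _ _)).trans <|
        csInf_le ⟨0, hV0 _ _⟩ ⟨n, (Nat.unpair_right_le j).trans hn, _, hξA n ω, hd, rfl⟩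
    · simpa [u, ballBump_eq_zero (not_lt.1 hd)] using hφ0 _ _
  · filter_upwards [ae_exists_seq_tendsto hmE P P₀ hA hξA hξ₀ hconv fun ω => hAc (hξ₀A ω)]
      with ω ⟨s, hsA, hs⟩ b hb
    obtain ⟨k, hk⟩ := exists_uniform_lower_bound
      (fun s hsA hs => hlim s (ξ₀ ω) hsA (hξ₀A ω) hs) hsA hs hb
    let l := 2 * k + 1
    have hl : 1 / (2 * ((l : ℝ) + 1)) + 1 / ((l : ℝ) + 1) ≤ 1 / ((k : ℝ) + 1) := by
      have : (l : ℝ) + 1 = 2 * ((k : ℝ) + 1) := by simp only [l]; push_cast; ring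
      rw [this]
      field_simp
      norm_num
    obtain ⟨_, ⟨i, rfl⟩, hi⟩ := Metric.mem_closure_iff.1 (hAc (hξ₀A ω))
      (1 / (2 * ((l : ℝ) + 1))) (by positivity)
    refine ⟨Nat.pair i l, ?_⟩
    simp only [u, Nat.unpair_pair, ballBump_eq_one hi, mul_one]
    refine le_csInf ?_ ?_
    · have hpos : 0 < 1 / ((l : ℝ) + 1) - dist (ξ₀ ω) (z i) := by
        have : 1 / (2 * ((l : ℝ) + 1)) ≤ 1 / ((l : ℝ) + 1) :=
          one_div_le_one_div_of_le (by positivity) (by linarith [l.cast_nonneg (α := ℝ)])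
        linarith
      obtain ⟨n, hn, hln⟩ :=
        ((hs.eventually_lt_const hpos).and (eventually_ge_atTop l)).exists
      exact ⟨_, n, hln, s n, hsA n, by linarith [dist_triangle (s n) (ξ₀ ω) (z i)], rfl⟩
    · rintro _ ⟨n, hn, y, hy, hyz, rfl⟩
      refine hk n (by omega) y hy ?_
      linarith [dist_triangle_right y (ξ₀ ω) (z i)]

/-- **Extended Continuous Mapping theorem for the open-ball σ-algebra** (Theorem D.2).
The maps `h_n : E_n → Ẽ` and `h₀ : E₀ → Ẽ` are modelled as total maps on `E` whose
values are only constrained (and only used) on `E_n` resp. `E₀`.  Measurability of `h₀`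
is with respect to the trace σ-algebra `ℬ₀° = {A ∩ E₀ : A ∈ ℬ°}` on the subtype `E₀`. -/
theorem extended_continuous_mapping
    {E : Type*} [MetricSpace E] [mE : MeasurableSpace E] (hmE : mE = ballSigma E)
    {F : Type*} [MetricSpace F] [mF : MeasurableSpace F] (hmF : mF = ballSigma F)
    {Ω : ℕ → Type*} [∀ n, MeasurableSpace (Ω n)]
    (P : ∀ n, Measure (Ω n)) (hP : ∀ n, IsProbabilityMeasure (P n))
    {Ω₀ : Type*} [MeasurableSpace Ω₀] (P₀ : Measure Ω₀) (hP₀ : IsProbabilityMeasure P₀)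
    (En : ℕ → Set E) (E₀ : Set E)
    (hE₀sep : TopologicalSpace.IsSeparable E₀) (hE₀meas : MeasurableSet E₀)
    (ξ : ∀ n, Ω n → E) (hξmeas : ∀ n, Measurable (ξ n)) (hξmem : ∀ n ω, ξ n ω ∈ En n)
    (ξ₀ : Ω₀ → E) (hξ₀meas : Measurable ξ₀) (hξ₀mem : ∀ ω₀, ξ₀ ω₀ ∈ E₀)
    (h : ℕ → E → F) (hhmeas : ∀ n, Measurable fun ω => h n (ξ n ω))
    (h₀ : E → F) (hh₀meas : Measurable fun x : E₀ => h₀ x.1)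
    -- (a) ξ_n converges in distribution° to ξ₀
    (hconv : ∀ f : E → ℝ, Continuous f → (∃ C, ∀ x, |f x| ≤ C) → Measurable f →
      Tendsto (fun n => ∫ ω, f (ξ n ω) ∂(P n)) atTop (𝓝 (∫ ω₀, f (ξ₀ ω₀) ∂P₀)))
    -- (b)
    (hcont : ∀ (x : ℕ → E) (x₀ : E), (∀ n, x n ∈ En n) → x₀ ∈ E₀ →
      Tendsto (fun n => dist (x n) x₀) atTop (𝓝 0) →
      Tendsto (fun n => dist (h n (x n)) (h₀ x₀)) atTop (𝓝 0)) :
    -- conclusion: h_n(ξ_n) converges in distribution° to h₀(ξ₀)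
    ∀ g : F → ℝ, Continuous g → (∃ C, ∀ y, |g y| ≤ C) → Measurable g →
      Tendsto (fun n => ∫ ω, g (h n (ξ n ω)) ∂(P n)) atTop
        (𝓝 (∫ ω₀, g (h₀ (ξ₀ ω₀)) ∂P₀)) := by
  rintro g hg ⟨C, hC⟩ hgm
  have hlim : ∀ (s : ℕ → E) (x : E), (∀ n, s n ∈ En n) → x ∈ E₀ →
      Tendsto (fun n => dist (s n) x) atTop (𝓝 0) →
      Tendsto (fun n => g (h n (s n))) atTop (𝓝 (g (h₀ x))) := fun s x hs hx hsx =>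
    (hg.tendsto _).comp (tendsto_iff_dist_tendsto_zero.2 (hcont s x hs hx hsx))
  have hm : ∀ n, Measurable fun ω => g (h n (ξ n ω)) := fun n => hgm.comp (hhmeas n)
  have hm₀ : Measurable fun ω => g (h₀ (ξ₀ ω)) :=
    hgm.comp (hh₀meas.comp (hξ₀meas.subtype_mk (h := hξ₀mem)))
  have hi : ∀ n, Integrable (fun ω => g (h n (ξ n ω))) (P n) := fun n =>
    .of_bound (hm n).aestronglyMeasurable C (.of_forall fun ω => hC _)
  have hi₀ : Integrable (fun ω => g (h₀ (ξ₀ ω))) P₀ :=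
    .of_bound hm₀.aestronglyMeasurable C (.of_forall fun ω => hC _)
  have hle : ∀ y, -C ≤ g y ∧ g y ≤ C := fun y => abs_le.1 (hC y)
  rw [tendsto_order]
  constructor
  · intro a ha
    have := eventually_lt_integral_of_seq_tendsto hmE P P₀ hE₀sep hξmeas hξmem hξ₀meas hξ₀mem hconv
      (φ := fun n x => C + g (h n x)) (φ₀ := fun x => C + g (h₀ x)) (C := 2 * C) (a := C + a)
      (fun n => (hm n).const_add C) (hm₀.const_add C)
      (fun n x => by linarith [hle (h n x)]) (fun n x => by linarith [hle (h n x)])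
      (fun x => abs_le.2 ⟨by linarith [hle (h₀ x)], by linarith [hle (h₀ x)]⟩)
      (fun s x hs hx hsx => (hlim s x hs hx hsx).const_add C)
      (by rw [integral_add (integrable_const _) hi₀]; simpa using ha)
    filter_upwards [this] with n hn
    rw [integral_add (integrable_const _) (hi n)] at hn
    simpa using hn
  · intro a ha
    have := eventually_lt_integral_of_seq_tendsto hmE P P₀ hE₀sep hξmeas hξmem hξ₀meas hξ₀mem hconv
      (φ := fun n x => C - g (h n x)) (φ₀ := fun x => C - g (h₀ x)) (C := 2 * C) (a := C - a)
      (fun n => (hm n).const_sub C) (hm₀.const_sub C)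
      (fun n x => by linarith [hle (h n x)]) (fun n x => by linarith [hle (h n x)])
      (fun x => abs_le.2 ⟨by linarith [hle (h₀ x)], by linarith [hle (h₀ x)]⟩)
      (fun s x hs hx hsx => (hlim s x hs hx hsx).const_sub C)
      (by rw [integral_sub (integrable_const _) hi₀]; simpa using ha)
    filter_upwards [this] with n hn
    rw [integral_sub (integrable_const _) (hi n)] at hn
    simpa using hn
end
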